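/- Let π : S₅^N → (ℤ/2ℤ)^N be the coordinate-wise sign homomorphism, and for linear codes C, C' ≤ 𝔽₂^N let G_C = π⁻¹(C) and G_{C'} = π⁻¹(C'). Then G_C and G_{C'} are isomorphic as abstract groups if and only if there is a permutation α ∈ S_N of the coordinates with C·α = C' (i.e., C and C' are permutation-equivalent linear codes). -/

import Mathlib

/-- The sign of a permutation of `{1,…,5}`, valued in `ℤ/2ℤ` (written multiplicatively). -/
noncomputable def signZMod : Equiv.Perm (Fin 5) →* Multiplicative (ZMod 2) :=
  MonoidHom.mk'
    (fun σ => Multiplicative.ofAdd (if Equiv.Perm.sign σ = 1 then (0 : ZMod 2) else 1))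
    (by
      intro a b
      rcases Int.units_eq_one_or (Equiv.Perm.sign a) with h1 | h1 <;>
        rcases Int.units_eq_one_or (Equiv.Perm.sign b) with h2 | h2 <;>
          simp only [Equiv.Perm.sign_mul, h1, h2] <;> decide)

/-- The coordinate-wise sign homomorphism `π : S₅^N → (ℤ/2ℤ)^N`. -/
noncomputable def signPi (N : ℕ) :
    (Fin N → Equiv.Perm (Fin 5)) →* Multiplicative (Fin N → ZMod 2) :=
  (MulEquiv.funMultiplicative (Fin N) (ZMod 2)).symm.toMonoidHom.comp
    (MonoidHom.compLeft signZMod (Fin N))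

/-- `G_C = π⁻¹(C)`, for a linear code `C ≤ 𝔽₂^N`. -/
noncomputable def codeGroup (N : ℕ) (C : Submodule (ZMod 2) (Fin N → ZMod 2)) :
    Subgroup (Fin N → Equiv.Perm (Fin 5)) :=
  Subgroup.comap (signPi N) (AddSubgroup.toSubgroup C.toAddSubgroup)

theorem eq_one_of_commute_alternatingGroup (σ : Equiv.Perm (Fin 5))
    (h : ∀ x ∈ alternatingGroup (Fin 5), σ * x = x * σ) : σ = 1 := by
  by_contra hσ
  obtain ⟨a, ha⟩ : ∃ a, σ a ≠ a := by
    by_contra! hall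
    exact hσ (Equiv.ext hall)
  obtain ⟨c, d, hca, hda, hcb, hdb, hcd⟩ : ∃ c d : Fin 5,
      c ≠ a ∧ d ≠ a ∧ c ≠ σ a ∧ d ≠ σ a ∧ c ≠ d := by
    generalize σ a = b
    clear ha
    revert a b
    decide
  have hx := h (Equiv.swap (σ a) c * Equiv.swap c d) (by
    rw [Equiv.Perm.mem_alternatingGroup, Equiv.Perm.sign_mul, Equiv.Perm.sign_swap hcb.symm,
      Equiv.Perm.sign_swap hcd]
    decide)
  have hxa := Equiv.congr_fun hx a
  simp only [Equiv.Perm.mul_apply] at hxa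
  rw [Equiv.swap_apply_of_ne_of_ne hca.symm hda.symm,
    Equiv.swap_apply_of_ne_of_ne ha.symm hca.symm,
    Equiv.swap_apply_of_ne_of_ne hcb.symm hdb.symm, Equiv.swap_apply_left] at hxa
  exact hcb hxa.symm

section Factors

variable {ι : Type*} [DecidableEq ι] {G G' : Subgroup (ι → Equiv.Perm (Fin 5))}

/-- The inclusion of the `i`-th factor `A₅` into a subgroup of `S₅^ι` containing `A₅^ι`. -/
def alternatingSingle (hG : Subgroup.pi Set.univ (fun _ => alternatingGroup (Fin 5)) ≤ G) (i : ι) :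
    alternatingGroup (Fin 5) →* G :=
  ((MonoidHom.mulSingle (fun _ : ι => Equiv.Perm (Fin 5)) i).comp
    (alternatingGroup (Fin 5)).subtype).codRestrict G fun a => hG fun j _ => by
      by_cases hj : j = i
      · subst hj
        simp
      · simp [Pi.mulSingle_eq_of_ne hj, one_mem]

variable (hG : Subgroup.pi Set.univ (fun _ => alternatingGroup (Fin 5)) ≤ G)
  (hG' : Subgroup.pi Set.univ (fun _ => alternatingGroup (Fin 5)) ≤ G')

theorem coe_alternatingSingle (i : ι) (a : alternatingGroup (Fin 5)) :
    (alternatingSingle hG i a : ι → Equiv.Perm (Fin 5)) =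
      Pi.mulSingle i (a : Equiv.Perm (Fin 5)) := rfl

theorem alternatingSingle_conj (i : ι) (g : G) (a : alternatingGroup (Fin 5)) :
    g * alternatingSingle hG i a * g⁻¹ =
      alternatingSingle hG i ⟨g.1 i * a * (g.1 i)⁻¹,
        (inferInstance : (alternatingGroup (Fin 5)).Normal).conj_mem _ a.2 _⟩ := by
  ext1
  funext j
  simp only [Subgroup.coe_mul, Subgroup.coe_inv, coe_alternatingSingle, Pi.mul_apply, Pi.inv_apply]
  by_cases hj : j = i
  · subst hj
    simp
  · simp [Pi.mulSingle_eq_of_ne hj]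

theorem alternatingSingle_injective (i : ι) : Function.Injective (alternatingSingle hG i) := by
  intro a b hab
  have := congrArg (fun g : G => g.1 i) hab
  simpa [coe_alternatingSingle] using this

theorem normal_range_alternatingSingle (i : ι) : (alternatingSingle hG i).range.Normal := by
  constructor
  rintro _ ⟨a, rfl⟩ g
  rw [alternatingSingle_conj]
  exact ⟨_, rfl⟩

theorem range_alternatingSingle_le (i : ι) (M : Subgroup G) [M.Normal] (m : G) (hm : m ∈ M)
    (hmi : m.1 i ≠ 1) : (alternatingSingle hG i).range ≤ M := by
  rcases (inferInstance : (M.comap (alternatingSingle hG i)).Normal).eq_bot_or_eq_top with h | h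
  · refine absurd (eq_one_of_commute_alternatingGroup (m.1 i) fun x hx => ?_) hmi
    have hmem : m * (alternatingSingle hG i ⟨x, hx⟩ * m⁻¹ * (alternatingSingle hG i ⟨x, hx⟩)⁻¹) ∈ M :=
      mul_mem hm ((inferInstance : M.Normal).conj_mem _ (inv_mem hm) _)
    rw [← mul_assoc, ← mul_assoc, alternatingSingle_conj, ← map_inv, ← map_mul,
      ← Subgroup.mem_comap, h, Subgroup.mem_bot, mul_inv_eq_one, Subtype.ext_iff] at hmem
    exact mul_inv_eq_iff_eq_mul.1 hmem
  · rintro _ ⟨a, rfl⟩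
    rw [← Subgroup.mem_comap, h]
    trivial

theorem exists_range_alternatingSingle_le (M : Subgroup G) [M.Normal] (hM : M ≠ ⊥) :
    ∃ i, (alternatingSingle hG i).range ≤ M := by
  obtain ⟨m, hm, hm1⟩ := M.bot_or_exists_ne_one.resolve_left hM
  obtain ⟨i, hi⟩ : ∃ i, m.1 i ≠ 1 := by
    by_contra! hall
    exact hm1 (Subtype.ext (funext hall))
  exact ⟨i, range_alternatingSingle_le hG i M m hm hi⟩

theorem range_alternatingSingle_ne_bot (i : ι) : (alternatingSingle hG i).range ≠ ⊥ := by
  rw [Ne, MonoidHom.range_eq_bot_iff]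
  intro h
  obtain ⟨a, ha⟩ := exists_ne (1 : alternatingGroup (Fin 5))
  exact ha (alternatingSingle_injective hG i (by simp [h]))

theorem eq_of_range_alternatingSingle_le {i k : ι}
    (h : (alternatingSingle hG k).range ≤ (alternatingSingle hG i).range) : k = i := by
  by_contra hk
  obtain ⟨a, ha⟩ := exists_ne (1 : alternatingGroup (Fin 5))
  obtain ⟨b, hb⟩ := h ⟨a, rfl⟩
  have := congrArg (fun g : G => g.1 k) hb
  simp only [coe_alternatingSingle, Pi.mulSingle_eq_same, Pi.mulSingle_eq_of_ne hk] at this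
  exact ha (Subtype.ext this.symm)

theorem exists_map_range_alternatingSingle_eq (φ : G ≃* G') (i : ι) :
    ∃ j, (alternatingSingle hG i).range.map φ.toMonoidHom = (alternatingSingle hG' j).range := by
  have := normal_range_alternatingSingle hG i
  have : ((alternatingSingle hG i).range.map φ.toMonoidHom).Normal :=
    this.map _ φ.surjective
  obtain ⟨j, hj⟩ := exists_range_alternatingSingle_le hG'
    ((alternatingSingle hG i).range.map φ.toMonoidHom) (by
      rw [Ne, Subgroup.map_eq_bot_iff_of_injective _ φ.injective]
      exact range_alternatingSingle_ne_bot hG i)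
  have := normal_range_alternatingSingle hG' j
  obtain ⟨k, hk⟩ := exists_range_alternatingSingle_le hG
    ((alternatingSingle hG' j).range.comap φ.toMonoidHom) (by
      intro h
      refine range_alternatingSingle_ne_bot hG' j ?_
      rw [← Subgroup.map_comap_eq_self_of_surjective (f := φ.toMonoidHom) φ.surjective
        (alternatingSingle hG' j).range, h, Subgroup.map_bot])
  have hki := eq_of_range_alternatingSingle_le hG (hk.trans <| (Subgroup.comap_mono hj).trans
    (Subgroup.comap_map_eq_self_of_injective φ.injective _).le)
  subst hki
  exact ⟨j, le_antisymm (Subgroup.map_le_iff_le_comap.2 hk) hj⟩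

theorem exists_perm_map_range_alternatingSingle_eq [Finite ι] (φ : G ≃* G') :
    ∃ α : Equiv.Perm ι, ∀ i,
      (alternatingSingle hG i).range.map φ.toMonoidHom = (alternatingSingle hG' (α i)).range := by
  choose α hα using exists_map_range_alternatingSingle_eq hG hG' φ
  have hinj : Function.Injective α := fun i k hik =>
    eq_of_range_alternatingSingle_le hG
      (Subgroup.map_injective φ.injective ((hα i).trans (hik ▸ (hα k).symm))).le
  exact ⟨Equiv.ofBijective α (Finite.injective_iff_bijective.1 hinj), hα⟩

theorem mem_alternatingGroup_iff_conj_inner (g : G) (i : ι) :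
    g.1 i ∈ alternatingGroup (Fin 5) ↔ ∃ a ∈ (alternatingSingle hG i).range,
      ∀ x ∈ (alternatingSingle hG i).range, g * x * g⁻¹ = a * x * a⁻¹ := by
  constructor
  · intro hg
    refine ⟨alternatingSingle hG i ⟨_, hg⟩, ⟨_, rfl⟩, ?_⟩
    rintro _ ⟨x, rfl⟩
    rw [alternatingSingle_conj, ← map_inv, ← map_mul, ← map_mul]
    rfl
  · rintro ⟨_, ⟨a, rfl⟩, h⟩
    have hone : (a : Equiv.Perm (Fin 5))⁻¹ * g.1 i = 1 := by
      refine eq_one_of_commute_alternatingGroup _ fun x hx => ?_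
      have hgx := congrArg (fun g : G => g.1 i) (h _ ⟨⟨x, hx⟩, rfl⟩)
      simp only [Subgroup.coe_mul, Subgroup.coe_inv, coe_alternatingSingle, Pi.mul_apply,
        Pi.inv_apply, Pi.mulSingle_eq_same] at hgx
      rw [mul_inv_eq_iff_eq_mul] at hgx
      rw [mul_assoc, hgx]
      group
    rw [← inv_mul_eq_one.1 hone]
    exact a.2

theorem apply_mem_alternatingGroup_iff (φ : G ≃* G') {i j : ι}
    (h : (alternatingSingle hG i).range.map φ.toMonoidHom = (alternatingSingle hG' j).range)
    (g : G) : (φ g).1 j ∈ alternatingGroup (Fin 5) ↔ g.1 i ∈ alternatingGroup (Fin 5) := by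
  rw [mem_alternatingGroup_iff_conj_inner hG', mem_alternatingGroup_iff_conj_inner hG, ← h]
  simp only [Subgroup.mem_map, exists_exists_and_eq_and, forall_exists_index, and_imp,
    forall_apply_eq_imp_iff₂, MulEquiv.toMonoidHom_eq_coe, MonoidHom.coe_coe, ← map_mul, ← map_inv,
    φ.injective.eq_iff]

end Factors

theorem mem_codeGroup_iff {N : ℕ} {C : Submodule (ZMod 2) (Fin N → ZMod 2)}
    {g : Fin N → Equiv.Perm (Fin 5)} :
    g ∈ codeGroup N C ↔ (fun i => (signZMod (g i)).toAdd) ∈ C := Iff.rfl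

theorem toAdd_signZMod (σ : Equiv.Perm (Fin 5)) :
    (signZMod σ).toAdd = if Equiv.Perm.sign σ = 1 then 0 else 1 := rfl

theorem pi_alternatingGroup_le_codeGroup {N : ℕ} (C : Submodule (ZMod 2) (Fin N → ZMod 2)) :
    Subgroup.pi Set.univ (fun _ => alternatingGroup (Fin 5)) ≤ codeGroup N C := by
  intro g hg
  rw [mem_codeGroup_iff]
  convert C.zero_mem
  rename_i i
  exact if_pos (hg i trivial)

theorem exists_toAdd_signZMod_eq (x : ZMod 2) :
    ∃ σ : Equiv.Perm (Fin 5), (signZMod σ).toAdd = x := by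
  simp only [toAdd_signZMod]
  rcases (by decide +revert : x = 0 ∨ x = 1) with rfl | rfl
  · exact ⟨1, by simp⟩
  · exact ⟨Equiv.swap 0 1, by simp⟩

theorem map_funLeft_eq_of_mulEquiv {N : ℕ} {C C' : Submodule (ZMod 2) (Fin N → ZMod 2)}
    (φ : codeGroup N C ≃* codeGroup N C') (α : Equiv.Perm (Fin N))
    (hα : ∀ i (g : codeGroup N C), (φ g).1 i ∈ alternatingGroup (Fin 5) ↔
      g.1 (α i) ∈ alternatingGroup (Fin 5)) :
    C.map (LinearMap.funLeft (ZMod 2) (ZMod 2) α) = C' := by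
  simp only [Equiv.Perm.mem_alternatingGroup] at hα
  have hsign (g : codeGroup N C) (i : Fin N) :
      (signZMod ((φ g).1 i)).toAdd = (signZMod (g.1 (α i))).toAdd := by
    simp only [toAdd_signZMod, hα]
  ext c
  choose s hs using exists_toAdd_signZMod_eq
  constructor
  · rintro ⟨c, hc, rfl⟩
    have hg : (fun i => s (c i)) ∈ codeGroup N C := by
      simpa [mem_codeGroup_iff, hs] using hc
    have := mem_codeGroup_iff.1 (φ ⟨_, hg⟩).2
    simp only [hsign, hs] at this
    exact this
  · intro hc
    have hg : (fun i => s (c i)) ∈ codeGroup N C' := by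
      simpa [mem_codeGroup_iff, hs] using hc
    refine ⟨_, mem_codeGroup_iff.1 (φ.symm ⟨_, hg⟩).2, funext fun i => ?_⟩
    rw [LinearMap.funLeft_apply, ← hsign, MulEquiv.apply_symm_apply, hs]

theorem map_arrowCongr_codeGroup {N : ℕ} (C : Submodule (ZMod 2) (Fin N → ZMod 2))
    (α : Equiv.Perm (Fin N)) :
    (codeGroup N C).map
        (MulEquiv.arrowCongr α.symm (MulEquiv.refl (Equiv.Perm (Fin 5))) :
          (Fin N → Equiv.Perm (Fin 5)) →* (Fin N → Equiv.Perm (Fin 5))) =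
      codeGroup N (C.map (LinearMap.funLeft (ZMod 2) (ZMod 2) α)) := by
  ext g
  constructor
  · rintro ⟨g, hg, rfl⟩
    exact ⟨_, hg, rfl⟩
  · rintro ⟨c, hc, hcg⟩
    refine ⟨g ∘ α.symm, ?_, funext fun i => congrArg g (α.symm_apply_apply i)⟩
    suffices h : (fun i => (signZMod (g (α.symm i))).toAdd) = c from
      mem_codeGroup_iff.2 (h ▸ hc)
    funext i
    have := congrFun hcg (α.symm i)
    rw [LinearMap.funLeft_apply, α.apply_symm_apply] at this
    exact this.symm

/-- For linear codes `C, C' ≤ 𝔽₂^N`, the groups `G_C = π⁻¹(C)` and `G_{C'} = π⁻¹(C')` are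
isomorphic as abstract groups if and only if `C` and `C'` are permutation-equivalent
linear codes. -/
theorem codeGroup_iso_iff_codes_equivalent (N : ℕ)
    (C C' : Submodule (ZMod 2) (Fin N → ZMod 2)) :
    Nonempty (↥(codeGroup N C) ≃* ↥(codeGroup N C')) ↔
      ∃ α : Equiv.Perm (Fin N),
        Submodule.map (LinearMap.funLeft (ZMod 2) (ZMod 2) ⇑α) C = C' := by
  constructor
  · rintro ⟨φ⟩
    have hC := pi_alternatingGroup_le_codeGroup C
    have hC' := pi_alternatingGroup_le_codeGroup C'
    obtain ⟨α, hα⟩ := exists_perm_map_range_alternatingSingle_eq hC hC' φ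
    refine ⟨α.symm, map_funLeft_eq_of_mulEquiv φ α.symm fun i g => ?_⟩
    refine apply_mem_alternatingGroup_iff hC hC' φ ?_ g
    rw [hα, α.apply_symm_apply]
  · rintro ⟨α, rfl⟩
    rw [← map_arrowCongr_codeGroup]
    exact ⟨MulEquiv.subgroupMap _ _⟩
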